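/- Let n ≥ 3 be a prime power. The map (i,j,k) ↦ k(n^3+1) − i(n^2−n+1) − j is a bijection from T(n) onto the gap set G(n) = ℕ \ S(n); in particular G(n) = { k(n^3+1) − i(n^2−n+1) − j : (i,j,k) ∈ T(n) }. -/

import Mathlib

/-- Membership condition for the index set `T(n)` of triples `(i,j,k)` indexing the
functions `y^i z^j / x^k` on the GK curve. -/
def memT (n i j k : ℤ) : Prop :=
  0 ≤ i ∧ i ≤ n ∧ 0 ≤ j ∧ j ≤ n ^ 2 - n ∧ 1 ≤ k ∧ k ≤ n ^ 2 - 1 ∧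
  (1 ≤ k ∧ k ≤ n - 1 →
    ((0 ≤ i ∧ i ≤ k ∧ k - i + 1 ≤ j ∧ j ≤ n ^ 2 - n) ∨
     (k + 1 ≤ i ∧ i ≤ n ∧ 0 ≤ j ∧ j ≤ n ^ 2 - n))) ∧
  (n ≤ k ∧ k ≤ n ^ 2 - n - 2 → k - i + 1 ≤ j ∧ j ≤ n ^ 2 - n) ∧
  (n ^ 2 - n - 1 ≤ k ∧ k ≤ n ^ 2 - 1 →
    (k - n ^ 2 + n + 1 ≤ i ∧ i ≤ n ∧ k - i + 1 ≤ j ∧ j ≤ n ^ 2 - n))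

/-- The set `T(n)` of triples `(i, j, k)`. -/
def T (n : ℤ) : Set (ℤ × ℤ × ℤ) := {x | memT n x.1 x.2.1 x.2.2}

/-- The map `γ(i,j,k) = (k(n^3+1) − i(n^2−n+1) − j, i(n^3−n^2+n) + j n^3 − k(n^3+1))`,
the pair of pole orders at `P₀` and `P∞` of `y^i z^j / x^k`. -/
def gammaMap (n : ℤ) (x : ℤ × ℤ × ℤ) : ℤ × ℤ :=
  (x.2.2 * (n ^ 3 + 1) - x.1 * (n ^ 2 - n + 1) - x.2.1,
   x.1 * (n ^ 3 - n ^ 2 + n) + x.2.1 * n ^ 3 - x.2.2 * (n ^ 3 + 1))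

/-- The gap set `G(n) = ℕ \ S(n)` (viewed inside `ℤ`) of the numerical semigroup `S(n)`
generated by `n^3 − n^2 + n`, `n^3` and `n^3 + 1`. -/
def Ggaps (n : ℤ) : Set ℤ :=
  {m | 0 ≤ m ∧ ¬ ∃ a b c : ℕ,
    m = (a : ℤ) * (n ^ 3 - n ^ 2 + n) + (b : ℤ) * n ^ 3 + (c : ℤ) * (n ^ 3 + 1)}

theorem memT_iff (n i j k : ℤ) (hn : 3 ≤ n) :
    memT n i j k ↔ 0 ≤ i ∧ i ≤ n ∧ 0 ≤ j ∧ j ≤ n ^ 2 - n ∧ 1 ≤ k ∧ k + 1 ≤ i + j := by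
  unfold memT
  have h : 3 * n ≤ n ^ 2 := by nlinarith
  generalize n ^ 2 = N at *
  constructor
  · rintro ⟨h1, h2, h3, h4, h5, h6, h7, h8, h9⟩
    refine ⟨h1, h2, h3, h4, h5, ?_⟩
    by_cases c1 : k ≤ n - 1
    · rcases h7 ⟨h5, c1⟩ with h | h <;> omega
    · by_cases c2 : k ≤ N - n - 2
      · have := h8 ⟨by omega, c2⟩
        omega
      · have := h9 ⟨by omega, h6⟩
        omega
  · rintro ⟨h1, h2, h3, h4, h5, h6⟩
    refine ⟨h1, h2, h3, h4, h5, by omega, ?_, ?_, ?_⟩ <;> intro h7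
    · by_cases c : i ≤ k
      · left; omega
      · right; omega
    · omega
    · omega

/-- Uniqueness of the mixed-radix representation. -/
theorem rep_unique (n M i j k i' j' k' : ℤ) (hi : 0 ≤ i) (hi2 : i ≤ n) (hj : 0 ≤ j)
    (hj2 : j < M) (hi' : 0 ≤ i') (hi2' : i' ≤ n) (hj' : 0 ≤ j') (hj2' : j' < M)
    (h : k * ((n + 1) * M) - i * M - j = k' * ((n + 1) * M) - i' * M - j') :
    i = i' ∧ j = j' ∧ k = k' := by
  have e1 : ((k - k') * (n + 1) - (i - i')) * M = j - j' := by linear_combination h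
  have z1 : (k - k') * (n + 1) - (i - i') = 0 := by
    have a1 : (k - k') * (n + 1) - (i - i') < 1 := by
      by_contra hc
      nlinarith
    have a2 : -1 < (k - k') * (n + 1) - (i - i') := by
      by_contra hc
      nlinarith
    omega
  have z2 : k - k' = 0 := by
    have a1 : k - k' < 1 := by
      by_contra hc
      nlinarith
    have a2 : -1 < k - k' := by
      by_contra hc
      nlinarith
    omega
  rw [z1] at e1
  rw [z2] at z1
  omega

/-- Existence of the mixed-radix representation. -/
theorem rep_exists (n M m : ℤ) (hn : 0 ≤ n) (hM : 0 < M) :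
    ∃ i j k : ℤ, 0 ≤ i ∧ i ≤ n ∧ 0 ≤ j ∧ j < M ∧ m = k * ((n + 1) * M) - i * M - j := by
  refine ⟨((-m) / M) % (n + 1), (-m) % M, -((-m) / M / (n + 1)), Int.emod_nonneg _ (by omega), ?_,
    Int.emod_nonneg _ (by omega), Int.emod_lt_of_pos _ hM, ?_⟩
  · have := Int.emod_lt_of_pos ((-m) / M) (show 0 < n + 1 by omega)
    omega
  · have a := Int.mul_ediv_add_emod (-m) M
    have b := Int.mul_ediv_add_emod ((-m) / M) (n + 1)
    linear_combination a + M * b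

theorem gap_iff (n M i j k : ℤ) (hn : 3 ≤ n) (hM : M = n ^ 2 - n + 1) (hi : 0 ≤ i) (hi2 : i ≤ n)
    (hj : 0 ≤ j) (hj2 : j < M) :
    k * ((n + 1) * M) - i * M - j ∈ Ggaps n ↔ 1 ≤ k ∧ k + 1 ≤ i + j := by
  have hMn : n < M := by nlinarith
  constructor
  · rintro ⟨h0, hs⟩
    have hlt : k + 1 ≤ i + j := by
      by_contra hc
      apply hs
      refine ⟨i.toNat, j.toNat, (k - i - j).toNat, ?_⟩
      rw [Int.toNat_of_nonneg hi, Int.toNat_of_nonneg hj, Int.toNat_of_nonneg (by omega), hM]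
      ring
    refine ⟨?_, hlt⟩
    by_contra hc
    have hk : k * ((n + 1) * M) ≤ 0 :=
      mul_nonpos_of_nonpos_of_nonneg (by omega) (by nlinarith)
    have hk0 : 0 ≤ k := by
      by_contra hk
      have : k * ((n + 1) * M) < 0 := mul_neg_of_neg_of_pos (by omega) (by nlinarith)
      nlinarith
    have h1 : i * M = 0 := by nlinarith
    have h2 : i = 0 := by
      rcases mul_eq_zero.1 h1 with h | h <;> omega
    have h3 : j = 0 := by nlinarith
    omega
  · rintro ⟨hk, hlt⟩
    refine ⟨?_, ?_⟩
    · have : 1 * ((n + 1) * M) ≤ k * ((n + 1) * M) :=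
        mul_le_mul_of_nonneg_right hk (by nlinarith)
      nlinarith
    · rintro ⟨a, b, c, h⟩
      have hM0 : 0 < M := by omega
      have hb1 := Int.mul_ediv_add_emod (b : ℤ) M
      have ht : 0 ≤ (b : ℤ) / M := Int.ediv_nonneg (by omega) (by omega)
      have hr := Int.emod_nonneg (b : ℤ) (show M ≠ 0 by omega)
      have hr2 := Int.emod_lt_of_pos (b : ℤ) hM0
      set t := (b : ℤ) / M
      set r := (b : ℤ) % M
      have ha1 := Int.mul_ediv_add_emod ((a : ℤ) + t) (n + 1)
      have hs : 0 ≤ ((a : ℤ) + t) / (n + 1) := Int.ediv_nonneg (by omega) (by omega)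
      have hu := Int.emod_nonneg ((a : ℤ) + t) (show n + 1 ≠ 0 by omega)
      have hu2 := Int.emod_lt_of_pos ((a : ℤ) + t) (show 0 < n + 1 by omega)
      set s := ((a : ℤ) + t) / (n + 1)
      set u := ((a : ℤ) + t) % (n + 1)
      have key : k * ((n + 1) * M) - i * M - j
          = ((a : ℤ) + b + c - s) * ((n + 1) * M) - u * M - r := by
        rw [h]
        subst hM
        linear_combination (n ^ 2 - n + 1) * ha1 + hb1
      obtain ⟨e1, e2, e3⟩ := rep_unique n M i j k u r _ hi hi2 hj hj2 hu (by omega) hr hr2 key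
      have p1 : 0 ≤ n * s := by positivity
      have p2 : 0 ≤ (M - 1) * t := mul_nonneg (by omega) ht
      have hc : (0 : ℤ) ≤ c := by omega
      nlinarith

/-- for a prime power `n ≥ 3`, the map
`(i,j,k) ↦ k(n^3+1) − i(n^2−n+1) − j` is a bijection from `T(n)` onto the gap set `G(n)`;
in particular `G(n)` is the image of `T(n)` under this map. -/
theorem first_coord_bijOn (n : ℕ) (hn : 3 ≤ n) (hpp : IsPrimePow n) :
    Set.BijOn
      (fun x : ℤ × ℤ × ℤ => x.2.2 * ((n : ℤ) ^ 3 + 1) - x.1 * ((n : ℤ) ^ 2 - n + 1) - x.2.1)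
      (T (n : ℤ)) (Ggaps (n : ℤ)) ∧
    Ggaps (n : ℤ) =
      (fun x : ℤ × ℤ × ℤ =>
        x.2.2 * ((n : ℤ) ^ 3 + 1) - x.1 * ((n : ℤ) ^ 2 - n + 1) - x.2.1) '' T (n : ℤ) := by
  have hn' : (3 : ℤ) ≤ n := by exact_mod_cast hn
  have hC : (n : ℤ) ^ 3 + 1 = ((n : ℤ) + 1) * ((n : ℤ) ^ 2 - n + 1) := by ring
  have hB : Set.BijOn
      (fun x : ℤ × ℤ × ℤ => x.2.2 * ((n : ℤ) ^ 3 + 1) - x.1 * ((n : ℤ) ^ 2 - n + 1) - x.2.1)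
      (T (n : ℤ)) (Ggaps (n : ℤ)) := by
    rw [hC]
    refine ⟨?_, ?_, ?_⟩
    · rintro ⟨i, j, k⟩ hx
      obtain ⟨h1, h2, h3, h4, h5⟩ := (memT_iff _ _ _ _ hn').1 hx
      exact (gap_iff n _ i j k hn' rfl h1 h2 h3 (by dsimp only at h4; omega)).2 h5
    · rintro ⟨i, j, k⟩ hx ⟨i', j', k'⟩ hx' he
      obtain ⟨h1, h2, h3, h4, h5⟩ := (memT_iff _ _ _ _ hn').1 hx
      obtain ⟨h1', h2', h3', h4', h5'⟩ := (memT_iff _ _ _ _ hn').1 hx'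
      dsimp only at *
      obtain ⟨rfl, rfl, rfl⟩ := rep_unique n _ i j k i' j' k' h1 h2 h3
        (show j < (n : ℤ) ^ 2 - n + 1 by omega) h1' h2' h3' (by omega) he
      rfl
    · intro m hm
      obtain ⟨i, j, k, h1, h2, h3, h4, rfl⟩ := rep_exists n ((n : ℤ) ^ 2 - n + 1) m (by omega)
        (by nlinarith)
      refine ⟨(i, j, k), ?_, rfl⟩
      exact (memT_iff _ _ _ _ hn').2
        ⟨h1, h2, h3, by dsimp only; omega, (gap_iff n _ i j k hn' rfl h1 h2 h3 h4).1 hm⟩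
  exact ⟨hB, hB.image_eq.symm⟩
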